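/- Let L be the Laplacian matrix of a strongly connected weighted digraph on N nodes, and let ξ be the positive left eigenvector of L associated with eigenvalue 0 normalized so that ∑_i ξ_i = 1. Then e^{−Lt} converges entrywise to the rank-one matrix 𝟙_N ξᵀ as t → ∞. -/

import Mathlib

open Matrix Filter

def IsAdjacencyMatrix {N : ℕ} (A : Matrix (Fin N) (Fin N) ℝ) : Prop :=
  (∀ i, A i i = 0) ∧ ∀ i j, 0 ≤ A i j

def IsStronglyConnected {N : ℕ} (A : Matrix (Fin N) (Fin N) ℝ) : Prop :=
  ∀ j i : Fin N, j ≠ i → ∃ (m : ℕ) (k : Fin (m + 1) → Fin N),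
    k 0 = j ∧ k (Fin.last m) = i ∧
    ∀ t : Fin m, 0 < A (k t.succ) (k t.castSucc)

def laplacian {N : ℕ} (A : Matrix (Fin N) (Fin N) ℝ) : Matrix (Fin N) (Fin N) ℝ :=
  Matrix.of fun i j => if i = j then ∑ k, A i k else -A i j

section helpers

lemma lap_apply {N : ℕ} (A : Matrix (Fin N) (Fin N) ℝ) (h0 : ∀ i, A i i = 0)
    (y : Fin N → ℝ) (i : Fin N) :
    ∑ j, laplacian A i j * y j = ∑ j, A i j * (y i - y j) := by
  have h : ∀ j, laplacian A i j * y j = (if i = j then (∑ k, A i k) * y j else 0) - A i j * y j := by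
    intro j
    by_cases hij : i = j
    · subst hij; simp [laplacian, h0]
    · simp [laplacian, hij]
  simp only [h, Finset.sum_sub_distrib, mul_sub, Finset.sum_ite_eq, Finset.mem_univ, if_true,
    Finset.sum_mul]

lemma left_null {N : ℕ} (A : Matrix (Fin N) (Fin N) ℝ) (h0 : ∀ i, A i i = 0)
    (ξ : Fin N → ℝ) (hleft : ξ ᵥ* laplacian A = 0) (y : Fin N → ℝ) :
    ∑ i, ξ i * ∑ j, A i j * (y i - y j) = 0 := by
  have h : (ξ ᵥ* laplacian A) ⬝ᵥ y = 0 := by rw [hleft]; simp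
  rw [← Matrix.dotProduct_mulVec] at h
  rw [← h]
  simp only [dotProduct, mulVec]
  refine Finset.sum_congr rfl fun i _ => ?_
  rw [lap_apply A h0]

lemma const_of_sc {N : ℕ} (A : Matrix (Fin N) (Fin N) ℝ) (hSC : IsStronglyConnected A)
    (y : Fin N → ℝ) (hy : ∀ i j, 0 < A i j → y i = y j) (i j : Fin N) : y i = y j := by
  by_cases hij : i = j
  · rw [hij]
  obtain ⟨m, k, h1, h2, h3⟩ := hSC i j hij
  have : ∀ t : Fin (m + 1), y (k t) = y i := by
    intro t
    induction t using Fin.induction with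
    | zero => rw [h1]
    | succ t ih => rw [← ih]; exact hy _ _ (h3 t)
  rw [← this (Fin.last m), h2]

lemma poincare {N : ℕ} (A : Matrix (Fin N) (Fin N) ℝ)
    (hA : IsAdjacencyMatrix A) (hSC : IsStronglyConnected A)
    (ξ : Fin N → ℝ) (hpos : ∀ i, 0 < ξ i) (hsum : ∑ i, ξ i = 1) :
    ∃ c > 0, ∀ y : Fin N → ℝ, ∑ i, ξ i * y i = 0 →
      c * ∑ i, ξ i * y i ^ 2 ≤ ∑ i, ξ i * ∑ j, A i j * (y i - y j) ^ 2 := by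
  let Q : (Fin N → ℝ) → ℝ := fun y => ∑ i, ξ i * ∑ j, A i j * (y i - y j) ^ 2
  have hQc : Continuous Q := by fun_prop
  have hin : ∀ (y : Fin N → ℝ) i j, 0 ≤ A i j * (y i - y j) ^ 2 := fun y i j =>
    mul_nonneg (hA.2 i j) (sq_nonneg _)
  have hin2 : ∀ (y : Fin N → ℝ) i, 0 ≤ ξ i * ∑ j, A i j * (y i - y j) ^ 2 := fun y i =>
    mul_nonneg (hpos i).le (Finset.sum_nonneg fun j _ => hin y i j)
  have hK : IsCompact (Metric.sphere (0 : Fin N → ℝ) 1 ∩ {y | ∑ i, ξ i * y i = 0}) := by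
    refine (isCompact_sphere _ _).inter_right (isClosed_eq ?_ continuous_const)
    fun_prop
  have hQpos : ∀ y ∈ (Metric.sphere (0 : Fin N → ℝ) 1 ∩ {y | ∑ i, ξ i * y i = 0}), 0 < Q y := by
    rintro y ⟨hy1, hy2⟩
    refine lt_of_le_of_ne (Finset.sum_nonneg fun i _ => hin2 y i) fun h => ?_
    have h' := (Finset.sum_eq_zero_iff_of_nonneg (fun i _ => hin2 y i)).1 h.symm
    have hc : ∀ i j, y i = y j := by
      refine const_of_sc A hSC y fun i j hij => ?_
      have h1 := h' i (Finset.mem_univ i)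
      have h2 := (mul_eq_zero.1 h1).resolve_left (hpos i).ne'
      have h3 := (Finset.sum_eq_zero_iff_of_nonneg (fun j _ => hin y i j)).1 h2 j (Finset.mem_univ j)
      have h4 := (mul_eq_zero.1 h3).resolve_left hij.ne'
      exact sub_eq_zero.1 (pow_eq_zero_iff (two_ne_zero) |>.1 h4)
    have hy0 : y = 0 := by
      funext i
      have h5 : ∑ j, ξ j * y j = 0 := hy2
      have h6 : ∑ j, ξ j * y j = ∑ j, ξ j * y i :=
        Finset.sum_congr rfl fun j _ => by rw [hc j i]
      rw [h6, ← Finset.sum_mul, hsum, one_mul] at h5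
      simpa using h5
    rw [hy0] at hy1
    simp at hy1
  obtain ⟨c, hc, hcQ⟩ := hK.exists_forall_le' hQc.continuousOn hQpos
  refine ⟨c, hc, fun y hy => ?_⟩
  by_cases hy0 : y = 0
  · subst hy0; simp
  have hn : 0 < ‖y‖ := norm_pos_iff.2 hy0
  have h1 := hcQ (‖y‖⁻¹ • y) ⟨by simp [norm_smul, hn.ne'], by
    have : ∑ i, ξ i * (‖y‖⁻¹ • y) i = ‖y‖⁻¹ * ∑ i, ξ i * y i := by
      rw [Finset.mul_sum]
      refine Finset.sum_congr rfl fun i _ => ?_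
      simp only [Pi.smul_apply, smul_eq_mul]; ring
    show ∑ i, ξ i * (‖y‖⁻¹ • y) i = 0
    rw [this, hy, mul_zero]⟩
  have h2 : Q (‖y‖⁻¹ • y) = (‖y‖⁻¹) ^ 2 * Q y := by
    simp only [Q, Finset.mul_sum, Pi.smul_apply, smul_eq_mul]
    refine Finset.sum_congr rfl fun i _ => Finset.sum_congr rfl fun j _ => ?_
    ring
  have h3 : ∑ i, ξ i * y i ^ 2 ≤ ‖y‖ ^ 2 := by
    calc ∑ i, ξ i * y i ^ 2 ≤ ∑ i, ξ i * ‖y‖ ^ 2 := by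
          refine Finset.sum_le_sum fun i _ => mul_le_mul_of_nonneg_left ?_ (hpos i).le
          rw [← sq_abs, ← Real.norm_eq_abs]
          exact pow_le_pow_left₀ (norm_nonneg _) (norm_le_pi_norm y i) 2
      _ = ‖y‖ ^ 2 := by rw [← Finset.sum_mul, hsum, one_mul]
  calc c * ∑ i, ξ i * y i ^ 2 ≤ c * ‖y‖ ^ 2 := mul_le_mul_of_nonneg_left h3 hc.le
    _ ≤ Q (‖y‖⁻¹ • y) * ‖y‖ ^ 2 := mul_le_mul_of_nonneg_right h1 (by positivity)
    _ = Q y := by rw [h2]; field_simp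

lemma decay {N : ℕ} (A : Matrix (Fin N) (Fin N) ℝ)
    (hA : IsAdjacencyMatrix A) (hSC : IsStronglyConnected A)
    (ξ : Fin N → ℝ) (hpos : ∀ i, 0 < ξ i) (hsum : ∑ i, ξ i = 1)
    (hleft : ξ ᵥ* laplacian A = 0) (y : ℝ → Fin N → ℝ)
    (hy : ∀ t i, HasDerivAt (fun s => y s i) (-(∑ j, laplacian A i j * y t j)) t)
    (hy0 : ∑ i, ξ i * y 0 i = 0) (i : Fin N) :
    Tendsto (fun t => y t i) atTop (nhds 0) := by
  obtain ⟨c, hc, hP⟩ := poincare A hA hSC ξ hpos hsum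
  simp only [lap_apply A hA.1] at hy
  have hmean : ∀ t, ∑ i, ξ i * y t i = 0 := by
    intro t
    have hd : ∀ t, HasDerivAt (fun s => ∑ i, ξ i * y s i) 0 t := by
      intro t
      have := HasDerivAt.fun_sum (u := Finset.univ) fun i _ => (hy t i).const_mul (ξ i)
      refine this.congr_deriv ?_
      simp only [mul_neg, Finset.sum_neg_distrib, left_null A hA.1 ξ hleft (y t), neg_zero]
    rw [← hy0]
    exact is_const_of_deriv_eq_zero (fun t => (hd t).differentiableAt) (fun t => (hd t).deriv) t 0
  let V : ℝ → ℝ := fun t => ∑ i, ξ i * y t i ^ 2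
  have hV : ∀ t, HasDerivAt V (-∑ i, ξ i * ∑ j, A i j * (y t i - y t j) ^ 2) t := by
    intro t
    have := HasDerivAt.fun_sum (u := Finset.univ) fun i _ => ((hy t i).pow 2).const_mul (ξ i)
    refine HasDerivAt.congr_deriv this ?_
    have h2 := left_null A hA.1 ξ hleft (fun i => y t i ^ 2)
    rw [← sub_eq_zero, ← neg_eq_zero, ← h2, ← Finset.sum_neg_distrib, ← Finset.sum_sub_distrib,
      ← Finset.sum_neg_distrib]
    refine Finset.sum_congr rfl fun i _ => ?_
    have : ∑ j, A i j * (y t i ^ 2 - y t j ^ 2) = 2 * y t i * ∑ j, A i j * (y t i - y t j)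
        - ∑ j, A i j * (y t i - y t j) ^ 2 := by
      rw [Finset.mul_sum, ← Finset.sum_sub_distrib]
      exact Finset.sum_congr rfl fun j _ => by ring
    rw [this]
    simp
    ring
  have hanti : Antitone fun t => Real.exp (c * t) * V t := by
    have hd : ∀ t, HasDerivAt (fun t => Real.exp (c * t) * V t)
        (Real.exp (c * t) * (c * 1) * V t + Real.exp (c * t) *
          (-∑ i, ξ i * ∑ j, A i j * (y t i - y t j) ^ 2)) t := fun t =>
      (((hasDerivAt_id t).const_mul c).exp).mul (hV t)
    refine antitone_of_deriv_nonpos (fun t => (hd t).differentiableAt) fun t => ?_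
    rw [(hd t).deriv]
    have h1 := hP (y t) (hmean t)
    have h2 := mul_le_mul_of_nonneg_left h1 (Real.exp_pos (c * t)).le
    simp only [V]
    linarith
  have hbound : ∀ t, 0 ≤ t → V t ≤ V 0 * Real.exp (-(c * t)) := by
    intro t ht
    have h := hanti ht
    simp only [mul_zero, Real.exp_zero, one_mul] at h
    rw [Real.exp_neg, ← div_eq_mul_inv, le_div_iff₀ (Real.exp_pos _)]
    linarith
  have hexp : Tendsto (fun t : ℝ => (ξ i)⁻¹ * (V 0 * Real.exp (-(c * t)))) atTop (nhds 0) := by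
    have h1 : Tendsto (fun t : ℝ => c * t) atTop atTop := tendsto_id.const_mul_atTop hc
    have h2 := (Real.tendsto_exp_neg_atTop_nhds_zero.comp h1).const_mul (V 0)
    have h3 := h2.const_mul (ξ i)⁻¹
    simpa using h3
  have hsq : Tendsto (fun t => y t i ^ 2) atTop (nhds 0) := by
    refine tendsto_of_tendsto_of_tendsto_of_le_of_le' tendsto_const_nhds hexp
      (Eventually.of_forall fun t => sq_nonneg _) ?_
    filter_upwards [eventually_ge_atTop 0] with t ht
    have h1 : ξ i * y t i ^ 2 ≤ V t :=
      Finset.single_le_sum (f := fun i => ξ i * y t i ^ 2)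
        (fun j _ => mul_nonneg (hpos j).le (sq_nonneg _)) (Finset.mem_univ i)
    rw [← div_eq_inv_mul, le_div_iff₀ (hpos i)]
    linarith [hbound t ht]
  have h := hsq.sqrt
  simp only [Real.sqrt_sq_eq_abs, Real.sqrt_zero] at h
  exact (tendsto_zero_iff_abs_tendsto_zero _).2 h

section
open scoped Matrix.Norms.Operator

lemma exp_deriv {N : ℕ} (L : Matrix (Fin N) (Fin N) ℝ) (t : ℝ) (i j : Fin N) :
    HasDerivAt (fun s : ℝ => (NormedSpace.exp (-(s • L)) : Matrix (Fin N) (Fin N) ℝ) i j)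
      (-(∑ k, L i k * (NormedSpace.exp (-(t • L)) : Matrix (Fin N) (Fin N) ℝ) k j)) t := by
  have h := hasDerivAt_exp_smul_const' (𝕂 := ℝ) (-L) t
  have h1 := (hasDerivAt_pi.1 ((hasDerivAt_pi.1 h) i)) j
  rw [show (fun s : ℝ => (NormedSpace.exp (-(s • L)) : Matrix (Fin N) (Fin N) ℝ) i j) =
    fun s : ℝ => (NormedSpace.exp (s • (-L)) : Matrix (Fin N) (Fin N) ℝ) i j from by
      funext s; rw [smul_neg]]
  refine HasDerivAt.congr_deriv h1 ?_
  simp [Matrix.mul_apply]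
  rfl

end

end helpers

/-- `e^{-Lt}` converges entrywise to the rank-one matrix `𝟙 ξᵀ`
(whose `(i,j)` entry is `ξ j`) as `t → ∞`. -/
theorem matrix_exp_neg_laplacian_tendsto_ones_xi
    {N : ℕ} (hN : 2 ≤ N) (A : Matrix (Fin N) (Fin N) ℝ)
    (hA : IsAdjacencyMatrix A) (hSC : IsStronglyConnected A)
    (ξ : Fin N → ℝ) (hpos : ∀ i, 0 < ξ i) (hsum : ∑ i, ξ i = 1)
    (hleft : ξ ᵥ* laplacian A = 0) :
    Tendsto (fun t : ℝ => NormedSpace.exp (-(t • laplacian A))) atTop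
      (nhds (Matrix.of fun _ j : Fin N => ξ j)) := by
  refine tendsto_pi_nhds.2 fun i => tendsto_pi_nhds.2 fun j => ?_
  have hmul : ∀ i, ∑ k, laplacian A i k * ξ j = 0 := fun i => by
    rw [lap_apply A hA.1 (fun _ => ξ j) i]; simp
  have h := decay A hA hSC ξ hpos hsum hleft
    (fun t i => (NormedSpace.exp (-(t • laplacian A)) : Matrix (Fin N) (Fin N) ℝ) i j - ξ j)
    (fun t i => by
      have := (exp_deriv (laplacian A) t i j).sub_const (ξ j)
      refine this.congr_deriv ?_
      simp only [mul_sub, Finset.sum_sub_distrib, hmul, sub_zero])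
    (by simp [mul_sub, Matrix.one_apply, ← Finset.sum_mul, hsum]) i
  have h2 := h.add_const (ξ j)
  simpa using h2
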